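/- arXiv:2101.07834 — 4 statements merged into one kernel-verified Lean document; each statement's English description precedes it below -/
import Mathlib

section
/- Let B be a unital C*-algebra, n a positive integer, and let v = (v_1, …, v_n) and b = (b_1, …, b_n) be tuples of elements of B, regarded as row matrices in M_{1,n}(B). Assume v is a row isometry (v* v = 1_n) and b is a strict row contraction (‖b b*‖ < 1). Then 1 − b b* is positive and invertible in B, 1_n − b* b is positive and invertible in M_n(B), 1 − v b* is invertible in B, and the row matrix w := (1 − b b*)^{1/2} (1 − v b*)^{-1} (b − v) (1_n − b* b)^{-1/2} ∈ M_{1,n}(B) satisfies w* w = 1_n; that is, w = (w_1, …, w_n) is again a row isometry (w_i* w_j = δ_{ij}·1 for all i, j). -/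
/- STATEMENT 0: the Möbius-type transform of a row isometry by a strict row
contraction is again a row isometry, together with the positivity and
invertibility assertions making the formula meaningful. -/

noncomputable section

open scoped Matrix

/-- `b v* = ∑ i, b i * (v i)*`, the product of the row `b` with the adjoint of the row `v`. -/
def rowMulStar {B : Type*} [NonUnitalNonAssocSemiring B] [StarRing B] {n : ℕ}
    (x y : Fin n → B) : B :=
  ∑ i, x i * star (y i)

/-- `b* b = [bᵢ* bⱼ] ∈ Mₙ(B)`, the product of the adjoint of the row `b` with the row `b`. -/
def gramMatrix {B : Type*} [NonUnitalNonAssocSemiring B] [StarRing B] {n : ℕ}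
    (b : Fin n → B) : Matrix (Fin n) (Fin n) B :=
  Matrix.of fun i j => star (b i) * b j

/-- Positivity in a C*-algebra: `x` is positive iff it is of the form `c* c`. -/
def IsPositive {B : Type*} [Mul B] [Star B] (x : B) : Prop := ∃ c, x = star c * c

/-- The Möbius-type transform
`w = (1 - b b*)^{1/2} (1 - v b*)⁻¹ (b - v) (1ₙ - b* b)^{-1/2}`,
where `s` is the positive square root `(1 - b b*)^{1/2}` and `t` is the positive square
root `(1ₙ - b* b)^{1/2}`. -/
def mobius {B : Type*} [Ring B] [StarRing B] {n : ℕ}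
    (s : B) (t : Matrix (Fin n) (Fin n) B) (b v : Fin n → B) : Fin n → B :=
  fun j => ∑ i, (s * Ring.inverse (1 - rowMulStar v b) * (b i - v i)) * Ring.inverse t i j

theorem IsPositive.isSelfAdjoint {B : Type*} [Semiring B] [StarRing B] {x : B}
    (hx : IsPositive x) : IsSelfAdjoint x := by
  obtain ⟨c, rfl⟩ := hx
  exact IsSelfAdjoint.star_mul_self c

theorem IsPositive.mul_self {B : Type*} [Semiring B] [StarRing B] {x : B}
    (hx : IsPositive x) : IsPositive (x * x) :=
  ⟨x, by rw [hx.isSelfAdjoint.star_eq]⟩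

section Algebra

variable {B : Type*} [Ring B] [StarRing B] {n : ℕ}

theorem star_rowMulStar (x y : Fin n → B) : star (rowMulStar x y) = rowMulStar y x := by
  simp [rowMulStar]

theorem star_mul_rowMulStar {v : Fin n → B}
    (hv : ∀ i j, star (v i) * v j = if i = j then (1 : B) else 0) (y : Fin n → B) (i : Fin n) :
    star (v i) * rowMulStar v y = star (y i) := by
  simp [rowMulStar, Finset.mul_sum, ← mul_assoc, hv]

theorem star_rowMulStar_mul_self {v : Fin n → B}
    (hv : ∀ i j, star (v i) * v j = if i = j then (1 : B) else 0) (b : Fin n → B) :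
    star (rowMulStar v b) * rowMulStar v b = rowMulStar b b := by
  rw [star_rowMulStar, rowMulStar, Finset.sum_mul]
  simp_rw [mul_assoc, star_mul_rowMulStar hv]
  rfl

theorem of_star_mul_mul_mul_of (b : Fin n → B) (c d : B) :
    (Matrix.of fun i j => star (b i) * c * b j) * (Matrix.of fun i j => star (b i) * d * b j) =
      Matrix.of fun i j => star (b i) * (c * rowMulStar b b * d) * b j := by
  ext i j
  simp [Matrix.mul_apply, rowMulStar, Finset.mul_sum, Finset.sum_mul, mul_assoc]

theorem isUnit_one_sub_gramMatrix {b : Fin n → B} (h : IsUnit (1 - rowMulStar b b)) :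
    IsUnit ((1 : Matrix (Fin n) (Fin n) B) - gramMatrix b) := by
  obtain ⟨e, he, he'⟩ := isUnit_iff_exists.1 h
  have hG : gramMatrix b = Matrix.of fun i j => star (b i) * 1 * b j := by
    ext i j; simp [gramMatrix]
  rw [sub_mul, one_mul, sub_eq_iff_eq_add] at he
  rw [mul_sub, mul_one, sub_eq_iff_eq_add] at he'
  refine isUnit_iff_exists.2 ⟨1 + Matrix.of fun i j => star (b i) * e * b j, ?_, ?_⟩
  · rw [hG, sub_mul, mul_add, mul_add, one_mul, one_mul, mul_one, of_star_mul_mul_mul_of]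
    ext i j
    nth_rw 1 [he]
    simp [mul_add, add_mul]
  · rw [hG, mul_sub, mul_one (1 + _), add_mul, one_mul, of_star_mul_mul_mul_of]
    ext i j
    nth_rw 1 [he']
    simp [mul_add, add_mul]

theorem star_sub_mul_inverse {v b : Fin n → B}
    (hv : ∀ i j, star (v i) * v j = if i = j then (1 : B) else 0)
    (hu : IsUnit (1 - rowMulStar v b)) (i : Fin n) :
    star (b i - v i) * Ring.inverse (1 - rowMulStar v b) = -star (v i) := by
  have h : star (b i - v i) = -star (v i) * (1 - rowMulStar v b) := by
    rw [mul_sub, neg_mul, neg_mul, star_mul_rowMulStar hv, star_sub]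
    noncomm_ring
  rw [h, Ring.mul_inverse_cancel_right _ _ hu]

theorem star_mobius_kernel_mul {v b : Fin n → B}
    (hv : ∀ i j, star (v i) * v j = if i = j then (1 : B) else 0)
    (hu : IsUnit (1 - rowMulStar v b)) {s : B} (hs : IsSelfAdjoint s)
    (hs_sq : s * s = 1 - rowMulStar b b) (i j : Fin n) :
    star (s * Ring.inverse (1 - rowMulStar v b) * (b i - v i)) *
      (s * Ring.inverse (1 - rowMulStar v b) * (b j - v j)) =
      ((1 : Matrix (Fin n) (Fin n) B) - gramMatrix b) i j := by
  have hi := star_sub_mul_inverse hv hu i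
  have hj := congrArg star (star_sub_mul_inverse hv hu j)
  have hx := star_rowMulStar_mul_self hv b
  have hy := Ring.mul_inverse_cancel _ hu
  have hy' := congrArg star hy
  have hvij := hv i j
  set x := rowMulStar v b
  set X := Ring.inverse (1 - x)
  have hK : star X * (s * s) * X = star X + X - 1 := by
    have e : s * s = (1 - x) + star (1 - x) - star (1 - x) * (1 - x) := by
      rw [hs_sq, ← hx, star_sub, star_one]; noncomm_ring
    rw [star_mul, star_one] at hy'
    rw [e, mul_sub, mul_add, sub_mul, add_mul, mul_assoc _ (1 - x), hy, hy', ← mul_assoc, hy',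
      one_mul, one_mul, mul_one, hy]
  simp only [star_mul, star_neg, star_star] at hj
  calc _ = star (b i - v i) * (star X * (s * s) * X) * (b j - v j) := by
        simp only [star_mul, hs.star_eq, mul_assoc]
    _ = star (b i - v i) * (star X * (b j - v j)) + star (b i - v i) * X * (b j - v j)
          - star (b i - v i) * (b j - v j) := by rw [hK]; noncomm_ring
    _ = 2 * (star (v i) * v j) - star (v i) * v j - star (b i) * b j := by
        rw [hj, hi, star_sub]; noncomm_ring
    _ = _ := by
        rw [hvij, Matrix.sub_apply, Matrix.one_apply, gramMatrix, Matrix.of_apply, two_mul]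
        noncomm_ring

theorem star_mobius_mul {v b : Fin n → B}
    (hv : ∀ i j, star (v i) * v j = if i = j then (1 : B) else 0)
    (hu : IsUnit (1 - rowMulStar v b)) {s : B} (hs : IsSelfAdjoint s)
    (hs_sq : s * s = 1 - rowMulStar b b) {t : Matrix (Fin n) (Fin n) B} (ht : IsSelfAdjoint t)
    (ht_sq : t * t = 1 - gramMatrix b) (ht_unit : IsUnit t) (i j : Fin n) :
    star (mobius s t b v i) * mobius s t b v j = if i = j then (1 : B) else 0 := by
  have hT : star (Ring.inverse t) = Ring.inverse t := by
    rw [← Ring.inverse_star, ht.star_eq]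
  have h1 : star (Ring.inverse t) * (t * t) * Ring.inverse t = 1 := by
    rw [hT, ← mul_assoc, Ring.inverse_mul_cancel _ ht_unit, one_mul,
      Ring.mul_inverse_cancel _ ht_unit]
  rw [← Matrix.one_apply, ← h1, ht_sq, Matrix.mul_assoc, Matrix.mul_apply]
  simp_rw [Matrix.mul_apply, ← star_mobius_kernel_mul hv hu hs hs_sq]
  simp [mobius, Finset.sum_mul, Finset.mul_sum, Matrix.star_apply, mul_assoc]
  exact Finset.sum_comm

end Algebra

theorem mobius_row_isometry {B : Type*} [CStarAlgebra B]
    {n : ℕ} (hn : 0 < n) (v b : Fin n → B)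
    (hv : ∀ i j, star (v i) * v j = if i = j then (1 : B) else 0)
    (hb : ‖rowMulStar b b‖ < 1)
    (s : B) (hs_pos : IsPositive s) (hs_sq : s * s = 1 - rowMulStar b b)
    (t : Matrix (Fin n) (Fin n) B) (ht_pos : IsPositive t)
    (ht_sq : t * t = 1 - gramMatrix b) :
    IsPositive (1 - rowMulStar b b) ∧ IsUnit (1 - rowMulStar b b) ∧
    IsPositive ((1 : Matrix (Fin n) (Fin n) B) - gramMatrix b) ∧
    IsUnit ((1 : Matrix (Fin n) (Fin n) B) - gramMatrix b) ∧
    IsUnit (1 - rowMulStar v b) ∧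
    (∀ i j, star (mobius s t b v i) * mobius s t b v j = if i = j then (1 : B) else 0) := by
  have hu1 : IsUnit (1 - rowMulStar b b) := isUnit_one_sub_of_norm_lt_one hb
  have hu2 := isUnit_one_sub_gramMatrix hu1
  have hu3 : IsUnit (1 - rowMulStar v b) := by
    refine isUnit_one_sub_of_norm_lt_one ?_
    rw [← star_rowMulStar_mul_self hv, CStarRing.norm_star_mul_self] at hb
    nlinarith [norm_nonneg (rowMulStar v b)]
  have ht_unit : IsUnit t := by
    rw [← ht_sq] at hu2
    exact ((Commute.refl t).isUnit_mul_iff.1 hu2).1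
  exact ⟨hs_sq ▸ hs_pos.mul_self, hu1, ht_sq ▸ ht_pos.mul_self, hu2, hu3,
    star_mobius_mul hv hu3 hs_pos.isSelfAdjoint hs_sq ht_pos.isSelfAdjoint ht_sq ht_unit⟩
end
end

section
/- Let B be a unital C*-algebra, A ⊆ B a unital C*-subalgebra (closed under adjoints and containing the unit of B), and α_1, …, α_n : A → A unital *-homomorphisms. Let v = (v_1, …, v_n) and b = (b_1, …, b_n) be tuples of elements of B with v a row isometry (v* v = 1_n) and b a strict row contraction (‖b b*‖ < 1), and assume the covariance relations a v_i = v_i α_i(a) and a b_i = b_i α_i(a) hold for all a ∈ A and 1 ≤ i ≤ n. Then the row isometry w := (1 − b b*)^{1/2} (1 − v b*)^{-1} (b − v) (1_n − b* b)^{-1/2} satisfies the same covariance relations: a w_i = w_i α_i(a) for all a ∈ A and 1 ≤ i ≤ n. -/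
/- STATEMENT 4: if the row isometry `v` and the strict row contraction `b` both satisfy
the covariance relations `a vᵢ = vᵢ αᵢ(a)` and `a bᵢ = bᵢ αᵢ(a)` (for a family of
unital *-endomorphisms `αᵢ` of a unital C*-subalgebra `A ⊆ B`), then the Möbius-type
transform `w` of `v` by `b` satisfies the same covariance relations. -/

noncomputable section

theorem Commute.ringInverse_right {M : Type*} [MonoidWithZero M] {a b : M} (h : Commute a b) :
    Commute a (Ring.inverse b) := by
  by_cases hb : IsUnit b
  · obtain ⟨u, rfl⟩ := hb
    rw [Ring.inverse_unit]
    exact h.units_inv_right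
  · rw [Ring.inverse_non_unit _ hb]
    exact Commute.zero_right a

theorem IsPositive.commute_of_commute_mul_self {B : Type*} [CStarAlgebra B] {s x : B}
    (hs : IsPositive s) (h : Commute x (s * s)) : Commute x s := by
  let _ := CStarAlgebra.spectralOrder B
  have := CStarAlgebra.spectralOrderedRing B
  obtain ⟨c, hc⟩ := hs
  have hs : 0 ≤ s := hc ▸ star_mul_self_nonneg c
  rw [← CFC.sqrt_mul_self s hs]
  exact (h.symm.cfcₙ_nnreal NNReal.sqrt).symm

theorem IsPositive.matrix_commute_of_commute_mul_self {B : Type*} [CStarAlgebra B] {n : ℕ}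
    {t x : Matrix (Fin n) (Fin n) B} (ht : IsPositive t) (h : Commute x (t * t)) :
    Commute x t := by
  let _ := CStarAlgebra.spectralOrder B
  have := CStarAlgebra.spectralOrderedRing B
  exact IsPositive.commute_of_commute_mul_self (B := CStarMatrix (Fin n) (Fin n) B)
    (s := CStarMatrix.ofMatrix t) (x := CStarMatrix.ofMatrix x) ht h

section Covariance

variable {B : Type*} [CStarAlgebra B] {A : StarSubalgebra ℂ B} {n : ℕ}
  {α : Fin n → (A →⋆ₐ[ℂ] A)} {x y : Fin n → B}

theorem map_mul_star_of_covariant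
    (hx : ∀ (a : A) (i : Fin n), (a : B) * x i = x i * ((α i a : A) : B)) (a : A) (i : Fin n) :
    ((α i a : A) : B) * star (x i) = star (x i) * (a : B) := by
  have h := congrArg star (hx (star a) i)
  simpa [map_star] using h.symm

theorem commute_rowMulStar_of_covariant
    (hx : ∀ (a : A) (i : Fin n), (a : B) * x i = x i * ((α i a : A) : B))
    (hy : ∀ (a : A) (i : Fin n), (a : B) * y i = y i * ((α i a : A) : B)) (a : A) :
    Commute (a : B) (rowMulStar x y) := by
  refine Commute.sum_right _ _ _ fun i _ => ?_
  rw [commute_iff_eq, ← mul_assoc, hx, mul_assoc, map_mul_star_of_covariant hy, mul_assoc]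

theorem commute_gramMatrix_of_covariant
    (hx : ∀ (a : A) (i : Fin n), (a : B) * x i = x i * ((α i a : A) : B)) (a : A) :
    Commute (Matrix.diagonal fun i => ((α i a : A) : B)) (gramMatrix x) := by
  rw [commute_iff_eq]
  ext i j
  rw [Matrix.diagonal_mul, Matrix.mul_diagonal, gramMatrix, Matrix.of_apply, ← mul_assoc,
    map_mul_star_of_covariant hx, mul_assoc, hx, mul_assoc]

end Covariance

theorem mobius_covariant {B : Type*} [CStarAlgebra B]
    (A : StarSubalgebra ℂ B) (hA : IsClosed (A : Set B))
    {n : ℕ} (hn : 0 < n) (α : Fin n → (A →⋆ₐ[ℂ] A))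
    (v b : Fin n → B)
    (hv : ∀ i j, star (v i) * v j = if i = j then (1 : B) else 0)
    (hb : ‖rowMulStar b b‖ < 1)
    (hcov_v : ∀ (a : A) (i : Fin n), (a : B) * v i = v i * ((α i a : A) : B))
    (hcov_b : ∀ (a : A) (i : Fin n), (a : B) * b i = b i * ((α i a : A) : B))
    (s : B) (hs_pos : IsPositive s) (hs_sq : s * s = 1 - rowMulStar b b)
    (t : Matrix (Fin n) (Fin n) B) (ht_pos : IsPositive t)
    (ht_sq : t * t = 1 - gramMatrix b) :
    ∀ (a : A) (i : Fin n),
      (a : B) * mobius s t b v i = mobius s t b v i * ((α i a : A) : B) := by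
  intro a j
  have hs : Commute (a : B) s := hs_pos.commute_of_commute_mul_self <| by
    rw [hs_sq]
    exact (Commute.one_right _).sub_right (commute_rowMulStar_of_covariant hcov_b hcov_b a)
  have hvb : Commute (a : B) (Ring.inverse (1 - rowMulStar v b)) :=
    ((Commute.one_right _).sub_right
      (commute_rowMulStar_of_covariant hcov_v hcov_b a)).ringInverse_right
  have ht : Commute (Matrix.diagonal fun i => ((α i a : A) : B)) (Ring.inverse t) := by
    refine (ht_pos.matrix_commute_of_commute_mul_self ?_).ringInverse_right
    rw [ht_sq]
    exact (Commute.one_right _).sub_right (commute_gramMatrix_of_covariant hcov_b a)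
  simp only [mobius, Finset.mul_sum, Finset.sum_mul]
  refine Finset.sum_congr rfl fun i _ => ?_
  have hij : ((α i a : A) : B) * Ring.inverse t i j =
      Ring.inverse t i j * ((α j a : A) : B) := by
    rw [← Matrix.diagonal_mul (fun i => ((α i a : A) : B)), ht.eq, Matrix.mul_diagonal]
  have hbv : (a : B) * (b i - v i) = (b i - v i) * ((α i a : A) : B) := by
    rw [mul_sub, sub_mul, hcov_b, hcov_v]
  rw [← mul_assoc, ← mul_assoc, (hs.mul_right hvb).eq, mul_assoc _ (a : B), hbv, ← mul_assoc,
    mul_assoc _ _ (Ring.inverse t i j), hij, ← mul_assoc]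
end
end

section
/- Let A be a unital C*-algebra, let α_1, …, α_n and β_1, …, β_m be unital *-endomorphisms of A, and let b ∈ M_{m,n}(A) be invertible, meaning there exists c ∈ M_{n,m}(A) with b c = 1_m and c b = 1_n. Assume that b intertwines the two families of endomorphisms: diag(β_1(a), …, β_m(a)) · b = b · diag(α_1(a), …, α_n(a)) for all a ∈ A. Then b* b ∈ M_n(A) is positive and invertible, and the partial-polar factor u := b (b* b)^{-1/2} ∈ M_{m,n}(A) is a unitary matrix (u* u = 1_n and u u* = 1_m) which also intertwines the endomorphisms: diag(β_1(a), …, β_m(a)) · u = u · diag(α_1(a), …, α_n(a)) for all a ∈ A. -/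
/- STATEMENT 6: an invertible matrix `b ∈ M_{m,n}(A)` intertwining two families of
unital *-endomorphisms has `b* b` positive and invertible, and its polar factor
`u = b (b* b)^{-1/2}` is a unitary matrix which intertwines the same endomorphisms.
Here `s` denotes the positive square root `(b* b)^{1/2}`, so that
`(b* b)^{-1/2} = s⁻¹`. -/

noncomputable section

open scoped Matrix

/-- An element commuting with the square of a positive element of a C*-algebra commutes with the
element itself. -/
theorem Commute.of_mul_self_isPositive {B : Type*} [CStarAlgebra B] {d s : B}
    (hs : IsPositive s) (h : Commute d (s * s)) : Commute d s := by
  let _ : PartialOrder B := CStarAlgebra.spectralOrder B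
  have _ : StarOrderedRing B := CStarAlgebra.spectralOrderedRing B
  obtain ⟨c, rfl⟩ := hs
  have hsqrt := CFC.sqrt_mul_self (star c * c) (star_mul_self_nonneg c)
  rw [← hsqrt]
  exact (Commute.cfcₙ_nnreal h.symm NNReal.sqrt).symm

theorem Matrix.commute_of_commute_mul_self_isPositive {ι A : Type*} [Fintype ι] [DecidableEq ι]
    [CStarAlgebra A] {d s : Matrix ι ι A} (hs : IsPositive s) (h : Commute d (s * s)) :
    Commute d s := by
  let _ : PartialOrder A := CStarAlgebra.spectralOrder A
  have _ : StarOrderedRing A := CStarAlgebra.spectralOrderedRing A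
  exact Commute.of_mul_self_isPositive (B := CStarMatrix ι ι A) hs h

theorem polar_factor_unitary_intertwines {A : Type*} [CStarAlgebra A]
    {m n : ℕ} (hm : 0 < m) (hn : 0 < n)
    (α : Fin n → (A →⋆ₐ[ℂ] A)) (β : Fin m → (A →⋆ₐ[ℂ] A))
    (b : Matrix (Fin m) (Fin n) A)
    (hinv : ∃ c : Matrix (Fin n) (Fin m) A, b * c = 1 ∧ c * b = 1)
    (hint : ∀ a : A,
      Matrix.diagonal (fun i => β i a) * b = b * Matrix.diagonal (fun j => α j a))
    (s : Matrix (Fin n) (Fin n) A) (hs_pos : IsPositive s) (hs_sq : s * s = bᴴ * b) :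
    IsPositive (bᴴ * b) ∧ IsUnit (bᴴ * b) ∧
    (b * Ring.inverse s)ᴴ * (b * Ring.inverse s) = 1 ∧
    (b * Ring.inverse s) * (b * Ring.inverse s)ᴴ = 1 ∧
    (∀ a : A,
      Matrix.diagonal (fun i => β i a) * (b * Ring.inverse s) =
        (b * Ring.inverse s) * Matrix.diagonal (fun j => α j a)) := by
  obtain ⟨c, hbc, hcb⟩ := hinv
  have hs_star : sᴴ = s := by
    obtain ⟨x, rfl⟩ := hs_pos
    exact (IsSelfAdjoint.star_mul_self x).star_eq
  have hcb_star : bᴴ * cᴴ = 1 := by rw [← Matrix.conjTranspose_mul, hcb, Matrix.conjTranspose_one]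
  have hbc_star : cᴴ * bᴴ = 1 := by rw [← Matrix.conjTranspose_mul, hbc, Matrix.conjTranspose_one]
  have hgram_right : (bᴴ * b) * (c * cᴴ) = 1 := by
    rw [Matrix.mul_assoc, ← Matrix.mul_assoc b, hbc, Matrix.one_mul, hcb_star]
  have hgram_left : (c * cᴴ) * (bᴴ * b) = 1 := by
    rw [Matrix.mul_assoc, ← Matrix.mul_assoc cᴴ, hbc_star, Matrix.one_mul, hcb]
  have hgram : IsUnit (bᴴ * b) := ⟨⟨_, _, hgram_right, hgram_left⟩, rfl⟩
  have hs_unit : IsUnit s := by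
    rw [← hs_sq, ← pow_two] at hgram
    exact (isUnit_pow_iff two_ne_zero).mp hgram
  have hst : s * Ring.inverse s = 1 := Ring.mul_inverse_cancel s hs_unit
  have hts : Ring.inverse s * s = 1 := Ring.inverse_mul_cancel s hs_unit
  have ht_star : (Ring.inverse s)ᴴ = Ring.inverse s := by
    rw [← Matrix.star_eq_conjTranspose, ← Ring.inverse_star, Matrix.star_eq_conjTranspose, hs_star]
  refine ⟨⟨s, by rw [Matrix.star_eq_conjTranspose, hs_star, hs_sq]⟩, hgram, ?_, ?_, fun a => ?_⟩
  · calc (b * Ring.inverse s)ᴴ * (b * Ring.inverse s)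
        = Ring.inverse s * (bᴴ * b) * Ring.inverse s := by
          simp only [Matrix.conjTranspose_mul, ht_star, Matrix.mul_assoc]
      _ = (Ring.inverse s * s) * (s * Ring.inverse s) := by
          rw [← hs_sq]; simp only [Matrix.mul_assoc]
      _ = 1 := by rw [hts, hst, Matrix.one_mul]
  · have htt : Ring.inverse s * Ring.inverse s = c * cᴴ := by
      refine left_inv_eq_right_inv (a := bᴴ * b) ?_ hgram_right
      rw [← hs_sq, mul_assoc, ← mul_assoc _ s s, hts, one_mul, hts]
    calc (b * Ring.inverse s) * (b * Ring.inverse s)ᴴ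
        = b * (Ring.inverse s * Ring.inverse s) * bᴴ := by
          simp only [Matrix.conjTranspose_mul, ht_star, Matrix.mul_assoc]
      _ = (b * c) * (cᴴ * bᴴ) := by rw [htt]; simp only [Matrix.mul_assoc]
      _ = 1 := by rw [hbc, hbc_star, Matrix.one_mul]
  · have hint_star : bᴴ * Matrix.diagonal (fun i => β i a) =
        Matrix.diagonal (fun j => α j a) * bᴴ := by
      have h := congrArg Matrix.conjTranspose (hint (star a))
      simpa [Matrix.conjTranspose_mul, Matrix.diagonal_conjTranspose, Pi.star_def, map_star] using h
    have hcomm_sq : Commute (Matrix.diagonal (fun j => α j a)) (s * s) := by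
      rw [hs_sq, commute_iff_eq, ← Matrix.mul_assoc, ← hint_star, Matrix.mul_assoc, hint,
        Matrix.mul_assoc]
    have hcomm := Matrix.commute_of_commute_mul_self_isPositive hs_pos hcomm_sq
    have hcomm_inv : Commute (Matrix.diagonal (fun j => α j a)) (Ring.inverse s) := by
      obtain ⟨v, rfl⟩ := hs_unit
      rw [Ring.inverse_unit]
      exact hcomm.units_inv_right
    rw [← Matrix.mul_assoc, hint, Matrix.mul_assoc, hcomm_inv.eq, Matrix.mul_assoc]
end
end

section
/- Let B be a unital C*-algebra, A ⊆ B a unital C*-subalgebra, and α_1, …, α_n : A → A unital *-homomorphisms. Let v = (v_1, …, v_n) be a row isometry in B (v* v = 1_n) satisfying a v_i = v_i α_i(a) for all a ∈ A and all i, and let b = (b_1, …, b_n) be a strict row contraction (‖b b*‖ < 1) with all b_i ∈ A satisfying a b_i = b_i α_i(a) for all a ∈ A and all i. Define w := (1 − b b*)^{1/2} (1 − v b*)^{-1} (b − v) (1_n − b* b)^{-1/2} ∈ M_{1,n}(B). Then: (1) w is a row isometry, w* w = 1_n; (2) w satisfies the same covariance relations, a w_i = w_i α_i(a) for all a ∈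 A and all i; and (3) 1 − w b* is invertible and (1 − b b*)^{1/2} (1 − w b*)^{-1} (b − w) (1_n − b* b)^{-1/2} = v, so the transform determined by b is an involution on covariant row isometries. -/
/- STATEMENT 7: the representation-level content of the Möbius-transform theorem:
for a covariant row isometry `v` and a strict row contraction `b` with entries in the
subalgebra `A` satisfying the covariance relations, the transform
`w = (1 - b b*)^{1/2} (1 - v b*)⁻¹ (b - v) (1ₙ - b* b)^{-1/2}` is again a covariant
row isometry, and applying the transform to `w` recovers `v`. -/

noncomputable section

/-- A positive element commutes with everything its square commutes with. -/
theorem IsPositive.commute_of_mul_self {C : Type*} [CStarAlgebra C] {x a : C}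
    (hx : IsPositive x) (h : Commute (x * x) a) : Commute x a := by
  let _ := CStarAlgebra.spectralOrder C
  have _ := CStarAlgebra.spectralOrderedRing C
  obtain ⟨c, rfl⟩ := hx
  have h0 : 0 ≤ star c * c := star_mul_self_nonneg c
  have h1 := h.cfc_nnreal NNReal.sqrt
  rwa [← CFC.sqrt_eq_cfc, CFC.sqrt_mul_self _ h0] at h1

namespace Matrix

section Positive

variable {B : Type*} {m n : Type*} [Fintype m] [Fintype n]

theorem IsPositive.conjTranspose_eq [NonUnitalSemiring B] [StarRing B] {p : Matrix n n B}
    (hp : IsPositive p) : pᴴ = p := by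
  obtain ⟨c, rfl⟩ := hp
  simp [star_eq_conjTranspose, conjTranspose_mul]

theorem IsPositive.diagonal [NonUnitalSemiring B] [StarRing B] [DecidableEq n] {s : B}
    (hs : IsPositive s) : IsPositive (Matrix.diagonal fun _ : n => s) := by
  obtain ⟨c, rfl⟩ := hs
  refine ⟨Matrix.diagonal fun _ => c, ?_⟩
  rw [star_eq_conjTranspose, diagonal_conjTranspose, diagonal_mul_diagonal]
  rfl

variable [CStarAlgebra B] [DecidableEq m] [DecidableEq n]

theorem IsPositive.commute_of_mul_self {p a : Matrix n n B}
    (hp : IsPositive p) (h : p * p * a = a * (p * p)) : p * a = a * p := by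
  let _ := CStarAlgebra.spectralOrder B
  have _ := CStarAlgebra.spectralOrderedRing B
  have hp' : IsPositive (CStarMatrix.ofMatrix p) := by
    obtain ⟨c, hc⟩ := hp
    exact ⟨CStarMatrix.ofMatrix c, congrArg CStarMatrix.ofMatrix hc⟩
  have h' : Commute (CStarMatrix.ofMatrix p * CStarMatrix.ofMatrix p)
      (CStarMatrix.ofMatrix a) := congrArg CStarMatrix.ofMatrix h
  exact congrArg CStarMatrix.ofMatrix.symm (hp'.commute_of_mul_self h').eq

/-- Positive square roots of intertwined matrices are intertwined. -/
theorem IsPositive.intertwine_of_mul_self {p : Matrix m m B} {q : Matrix n n B}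
    {r : Matrix m n B} (hp : IsPositive p) (hq : IsPositive q)
    (h : p * p * r = r * (q * q)) : p * r = r * q := by
  have hpq : IsPositive (fromBlocks p 0 0 q) := by
    obtain ⟨c, rfl⟩ := hp
    obtain ⟨d, rfl⟩ := hq
    exact ⟨fromBlocks c 0 0 d, by
      simp [star_eq_conjTranspose, fromBlocks_conjTranspose, fromBlocks_multiply]⟩
  have key := IsPositive.commute_of_mul_self (a := fromBlocks 0 r 0 0) hpq
    (by simp [fromBlocks_multiply, h])
  simpa [fromBlocks_multiply, fromBlocks_inj] using key

end Positive

section Mobius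

variable {B : Type*} [Ring B] [StarRing B] {m n : Type*} [Fintype m] [Fintype n]
  [DecidableEq m] {s s' u x : Matrix m m B} {t t' : Matrix n n B} {b v : Matrix m n B}

theorem one_sub_mobius_mul_conjTranspose (hx : x = 1 - v * bᴴ) (hux : u * x = 1)
    (hss : s * s = 1 - b * bᴴ) (hss' : s * s' = 1) (hb : t' * bᴴ = bᴴ * s') :
    1 - s * u * (b - v) * t' * bᴴ = s * u * s := by
  have e : (b - v) * bᴴ = x - s * s := by rw [hx, hss, Matrix.sub_mul]; abel
  rw [Matrix.mul_assoc _ t', hb, ← Matrix.mul_assoc, Matrix.mul_assoc _ _ bᴴ, e, Matrix.mul_sub,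
    Matrix.mul_assoc s u x, hux, Matrix.mul_one, Matrix.sub_mul, hss', ← Matrix.mul_assoc,
    Matrix.mul_assoc _ s s', hss', Matrix.mul_one, sub_sub_cancel]

variable [DecidableEq n]

theorem mobius_conjTranspose_mul_self (hv : vᴴ * v = 1) (hx : x = 1 - v * bᴴ)
    (hxu : x * u = 1) (hux : u * x = 1) (hs : sᴴ = s) (hss : s * s = 1 - b * bᴴ)
    (htt : t * t = 1 - bᴴ * b) (ht' : t'ᴴ = t') (htt' : t * t' = 1) (ht't : t' * t = 1) :
    (s * u * (b - v) * t')ᴴ * (s * u * (b - v) * t') = 1 := by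
  have hxu' : uᴴ * xᴴ = 1 := by rw [← conjTranspose_mul, hxu, conjTranspose_one]
  have h1 : s * s = x + xᴴ - xᴴ * x := by
    have : b * vᴴ * (v * bᴴ) = b * bᴴ := by
      rw [Matrix.mul_assoc, ← Matrix.mul_assoc vᴴ, hv, Matrix.one_mul]
    rw [hss, hx]
    simp only [conjTranspose_sub, conjTranspose_one, conjTranspose_mul,
      conjTranspose_conjTranspose, Matrix.mul_sub, Matrix.sub_mul, Matrix.one_mul,
      Matrix.mul_one, this]
    abel
  have h2 : uᴴ * (s * s) * u = uᴴ + u - 1 := by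
    have e1 : uᴴ * x * u = uᴴ := by rw [Matrix.mul_assoc, hxu, Matrix.mul_one]
    have e2 : uᴴ * (xᴴ * x) * u = 1 := by
      rw [← Matrix.mul_assoc, hxu', Matrix.one_mul, hxu]
    rw [h1]
    simp only [Matrix.mul_sub, Matrix.sub_mul, Matrix.mul_add, Matrix.add_mul, e1, e2, hxu',
      Matrix.one_mul]
  have h3 : (b - v)ᴴ * (u * v) = -1 := by
    have e : x * (u * v) = v := by rw [← Matrix.mul_assoc, hxu, Matrix.one_mul]
    have e' := congrArg (vᴴ * ·) e
    simp only [hx, Matrix.sub_mul, Matrix.mul_sub, Matrix.one_mul, hv, ← Matrix.mul_assoc] at e'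
    rw [conjTranspose_sub, Matrix.sub_mul, ← neg_sub, ← Matrix.mul_assoc, ← Matrix.mul_assoc, e']
  have h4 : u * (b - v) = b - u * v * (t * t) := by
    have e : b - v = x * b - v * (t * t) := by
      rw [hx, htt]
      simp only [Matrix.sub_mul, Matrix.mul_sub, Matrix.one_mul, Matrix.mul_one, Matrix.mul_assoc]
      abel
    rw [e, Matrix.mul_sub, ← Matrix.mul_assoc, hux, Matrix.one_mul, Matrix.mul_assoc]
  have h5 : (b - v)ᴴ * u * (b - v) = (b - v)ᴴ * b + t * t := by
    rw [Matrix.mul_assoc, h4, Matrix.mul_sub, ← Matrix.mul_assoc, h3]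
    simp
  have htstar : (t * t)ᴴ = t * t := by rw [htt]; simp
  have h6 : (b - v)ᴴ * uᴴ * (b - v) = bᴴ * (b - v) + t * t := by
    have := congrArg conjTranspose h5
    rwa [conjTranspose_add, htstar, conjTranspose_mul, conjTranspose_mul, conjTranspose_mul,
      conjTranspose_conjTranspose, ← Matrix.mul_assoc] at this
  have h7 : (b - v)ᴴ * (uᴴ * (s * s) * u) * (b - v) = t * t := by
    rw [h2]
    simp only [Matrix.mul_sub (b - v)ᴴ, Matrix.mul_add (b - v)ᴴ, Matrix.mul_one,
      Matrix.sub_mul _ _ (b - v), Matrix.add_mul _ _ (b - v), h5, h6]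
    simp only [conjTranspose_sub, Matrix.mul_sub, Matrix.sub_mul, hv, htt]
    abel
  calc (s * u * (b - v) * t')ᴴ * (s * u * (b - v) * t')
      = t' * ((b - v)ᴴ * (uᴴ * (s * s) * u) * (b - v)) * t' := by
        simp only [conjTranspose_mul, hs, ht', Matrix.mul_assoc]
    _ = 1 := by rw [h7, ← Matrix.mul_assoc, ht't, Matrix.one_mul, htt']

theorem mobius_mobius (hx : x = 1 - v * bᴴ) (hxu : x * u = 1) (htt : t * t = 1 - bᴴ * b)
    (htt' : t * t' = 1) (hss' : s * s' = 1) (hs's : s' * s = 1) (hb : s' * b = b * t') :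
    s * (s' * x * s') * (b - s * u * (b - v) * t') * t' = v := by
  have e1 : s * (s' * x * s') = x * s' := by
    rw [← Matrix.mul_assoc, ← Matrix.mul_assoc, hss', Matrix.one_mul]
  have e2 : x * s' * (s * u * (b - v) * t') = (b - v) * t' := by
    calc x * s' * (s * u * (b - v) * t') = x * ((s' * s) * u) * (b - v) * t' := by
          simp only [Matrix.mul_assoc]
      _ = (b - v) * t' := by rw [hs's, Matrix.one_mul, hxu, Matrix.one_mul]
  have e3 : x * b - (b - v) = v * (t * t) := by
    rw [hx, htt]
    simp only [Matrix.sub_mul, Matrix.mul_sub, Matrix.one_mul, Matrix.mul_one, Matrix.mul_assoc]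
    abel
  rw [e1, Matrix.mul_sub, e2, Matrix.mul_assoc x, hb, ← Matrix.mul_assoc, ← Matrix.sub_mul, e3,
    Matrix.mul_assoc v, Matrix.mul_assoc t, htt', Matrix.mul_one, Matrix.mul_assoc, htt',
    Matrix.mul_one]

end Mobius

end Matrix

section Row

open Matrix

theorem replicateRow_mul_conjTranspose {B : Type*} [NonUnitalNonAssocSemiring B] [StarRing B]
    {n : ℕ} (x y : Fin n → B) :
    replicateRow Unit x * (replicateRow Unit y)ᴴ = diagonal fun _ => rowMulStar x y := by
  ext i j
  simp [Matrix.mul_apply, rowMulStar]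

theorem replicateRow_conjTranspose_mul {B : Type*} [NonUnitalNonAssocSemiring B] [StarRing B]
    {n : ℕ} (x : Fin n → B) :
    (replicateRow Unit x)ᴴ * replicateRow Unit x = gramMatrix x := by
  ext i j
  simp [Matrix.mul_apply, gramMatrix]

theorem replicateRow_mobius {B : Type*} [Ring B] [StarRing B] {n : ℕ}
    (s : B) (t : Matrix (Fin n) (Fin n) B) (b v : Fin n → B) :
    replicateRow Unit (mobius s t b v) =
      (diagonal fun _ : Unit => s) *
        (diagonal fun _ : Unit => Ring.inverse (1 - rowMulStar v b)) *
        (replicateRow Unit b - replicateRow Unit v) * Ring.inverse t := by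
  ext i j
  rw [diagonal_mul_diagonal, Matrix.mul_apply]
  simp [mobius, diagonal_mul]

theorem isUnit_one_sub_rowMulStar {B : Type*} [CStarAlgebra B] {n : ℕ} {v b : Fin n → B}
    (hv : gramMatrix v = 1) (hb : ‖rowMulStar b b‖ < 1) : IsUnit (1 - rowMulStar v b) := by
  apply isUnit_one_sub_of_norm_lt_one
  have h : star (rowMulStar v b) * rowMulStar v b = rowMulStar b b := by
    have h' : (diagonal fun _ : Unit => star (rowMulStar v b) * rowMulStar v b) =
        diagonal fun _ => rowMulStar b b := by
      rw [← diagonal_mul_diagonal, ← replicateRow_mul_conjTranspose,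
        ← replicateRow_mul_conjTranspose, ← Pi.star_def, ← diagonal_conjTranspose,
        ← replicateRow_mul_conjTranspose, conjTranspose_mul, conjTranspose_conjTranspose,
        Matrix.mul_assoc, ← Matrix.mul_assoc _ (replicateRow Unit v),
        replicateRow_conjTranspose_mul, hv, Matrix.one_mul]
    exact congrFun₂ h' () ()
  have h2 : ‖rowMulStar v b‖ * ‖rowMulStar v b‖ < 1 := by
    rwa [← CStarRing.norm_star_mul_self, h]
  nlinarith [norm_nonneg (rowMulStar v b)]

end Row

theorem mobius_covariant_involution {B : Type*} [CStarAlgebra B]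
    (A : StarSubalgebra ℂ B) (hA : IsClosed (A : Set B))
    {n : ℕ} (hn : 0 < n) (α : Fin n → (A →⋆ₐ[ℂ] A))
    (v : Fin n → B)
    (hv : ∀ i j, star (v i) * v j = if i = j then (1 : B) else 0)
    (hcov_v : ∀ (a : A) (i : Fin n), (a : B) * v i = v i * ((α i a : A) : B))
    (b : Fin n → A)
    (hb : ‖rowMulStar (fun i => (b i : B)) (fun i => (b i : B))‖ < 1)
    (hcov_b : ∀ (a : A) (i : Fin n), a * b i = b i * α i a)
    (s : B) (hs_pos : IsPositive s)
    (hs_sq : s * s = 1 - rowMulStar (fun i => (b i : B)) (fun i => (b i : B)))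
    (t : Matrix (Fin n) (Fin n) B) (ht_pos : IsPositive t)
    (ht_sq : t * t = 1 - gramMatrix (fun i => (b i : B))) :
    (∀ i j,
      star (mobius s t (fun i => (b i : B)) v i) * mobius s t (fun i => (b i : B)) v j =
        if i = j then (1 : B) else 0) ∧
    (∀ (a : A) (i : Fin n),
      (a : B) * mobius s t (fun i => (b i : B)) v i =
        mobius s t (fun i => (b i : B)) v i * ((α i a : A) : B)) ∧
    IsUnit (1 - rowMulStar (mobius s t (fun i => (b i : B)) v) (fun i => (b i : B))) ∧
    mobius s t (fun i => (b i : B)) (mobius s t (fun i => (b i : B)) v) = v := by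
  set β : Fin n → B := fun i => (b i : B)
  set V := Matrix.replicateRow Unit v
  set b' := Matrix.replicateRow Unit β
  have hgv : gramMatrix v = 1 := by
    ext i j
    simp [gramMatrix, hv, Matrix.one_apply]
  have hVV : V.conjTranspose * V = 1 := by rw [replicateRow_conjTranspose_mul, hgv]
  have hsu : IsUnit s := by
    rw [← isUnit_mul_self_iff, hs_sq]
    exact isUnit_one_sub_of_norm_lt_one hb
  set x := 1 - rowMulStar v β with hx
  have hxU : IsUnit x := isUnit_one_sub_rowMulStar hgv hb
  set u := Ring.inverse x
  set s' := Ring.inverse s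
  let d : B → Matrix Unit Unit B := fun a => Matrix.diagonal fun _ => a
  have d_mul (p q : B) : d p * d q = d (p * q) := Matrix.diagonal_mul_diagonal _ _
  have d_one : d 1 = 1 := Matrix.diagonal_one
  have d_sub (p q : B) : d (p - q) = d p - d q := by ext; simp [d]
  have hdx : d x = 1 - V * b'.conjTranspose := by
    rw [hx, d_sub, d_one, replicateRow_mul_conjTranspose]
  have hdxu : d x * d u = 1 := by rw [d_mul, Ring.mul_inverse_cancel _ hxU, d_one]
  have hdux : d u * d x = 1 := by rw [d_mul, Ring.inverse_mul_cancel _ hxU, d_one]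
  have hdss' : d s * d s' = 1 := by rw [d_mul, Ring.mul_inverse_cancel _ hsu, d_one]
  have hds's : d s' * d s = 1 := by rw [d_mul, Ring.inverse_mul_cancel _ hsu, d_one]
  have hds_pos : IsPositive (d s) := Matrix.IsPositive.diagonal hs_pos
  have hds := Matrix.IsPositive.conjTranspose_eq hds_pos
  have hdss : d s * d s = 1 - b' * b'.conjTranspose := by
    rw [d_mul, hs_sq, d_sub, d_one, replicateRow_mul_conjTranspose]
  have htt : t * t = 1 - b'.conjTranspose * b' := by
    rw [ht_sq, replicateRow_conjTranspose_mul]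
  have hst : d s * b' = b' * t := by
    apply Matrix.IsPositive.intertwine_of_mul_self hds_pos ht_pos
    rw [hdss, htt, Matrix.sub_mul, Matrix.mul_sub, Matrix.one_mul, Matrix.mul_one,
      Matrix.mul_assoc]
  have ht := Matrix.IsPositive.conjTranspose_eq ht_pos
  have htu : IsUnit t := by
    have hc : b' * (t * t) = d s * d s * b' := by
      rw [Matrix.mul_assoc, hst, ← Matrix.mul_assoc, ← Matrix.mul_assoc, hst]
    have hc' : t * t * b'.conjTranspose = b'.conjTranspose * (d s * d s) := by
      have := congrArg Matrix.conjTranspose hc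
      simpa only [Matrix.conjTranspose_mul, ht, hds] using this
    have hi : d s * d s * (d s' * d s') = 1 := by
      rw [Matrix.mul_assoc, ← Matrix.mul_assoc (d s) (d s'), hdss', Matrix.one_mul, hdss']
    have hi' : d s' * d s' * (d s * d s) = 1 := by
      rw [Matrix.mul_assoc, ← Matrix.mul_assoc (d s') (d s), hds's, Matrix.one_mul, hds's]
    rw [← isUnit_mul_self_iff, isUnit_iff_exists]
    refine ⟨1 + b'.conjTranspose * (d s' * d s') * b', ?_, ?_⟩
    · rw [Matrix.mul_add, Matrix.mul_one, ← Matrix.mul_assoc, ← Matrix.mul_assoc, hc',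
        Matrix.mul_assoc _ (d s * d s), hi, Matrix.mul_one, htt, sub_add_cancel]
    · rw [Matrix.add_mul, Matrix.one_mul, Matrix.mul_assoc _ b', hc, ← Matrix.mul_assoc,
        Matrix.mul_assoc _ (d s' * d s'), hi', Matrix.mul_one, htt, sub_add_cancel]
  set t' := Ring.inverse t
  have htt' : t * t' = 1 := Ring.mul_inverse_cancel _ htu
  have ht't : t' * t = 1 := Ring.inverse_mul_cancel _ htu
  have ht's : t'.conjTranspose = t' := by
    have e := congrArg Matrix.conjTranspose htt'
    rw [Matrix.conjTranspose_mul, ht, Matrix.conjTranspose_one] at e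
    exact left_inv_eq_right_inv e htt'
  have hds' : (d s').conjTranspose = d s' := by
    have e := congrArg Matrix.conjTranspose hdss'
    rw [Matrix.conjTranspose_mul, hds, Matrix.conjTranspose_one] at e
    exact left_inv_eq_right_inv e hdss'
  have hs'b : d s' * b' = b' * t' := by
    calc d s' * b' = d s' * (b' * t) * t' := by
          rw [Matrix.mul_assoc, Matrix.mul_assoc, htt', Matrix.mul_one]
      _ = b' * t' := by rw [← hst, ← Matrix.mul_assoc, hds's, Matrix.one_mul]
  have ht'b : t' * b'.conjTranspose = b'.conjTranspose * d s' := by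
    have := congrArg Matrix.conjTranspose hs'b
    rw [Matrix.conjTranspose_mul, Matrix.conjTranspose_mul, ht's, hds'] at this
    exact this.symm
  set w := mobius s t β v
  have hW : Matrix.replicateRow Unit w = d s * d u * (b' - V) * t' := replicateRow_mobius _ _ _ _
  have hWW : (Matrix.replicateRow Unit w).conjTranspose * Matrix.replicateRow Unit w = 1 := by
    rw [hW]
    exact Matrix.mobius_conjTranspose_mul_self hVV hdx hdxu hdux hds hdss htt ht's htt' ht't
  have hdw : d (1 - rowMulStar w β) = d s * d u * d s := by
    rw [d_sub, d_one, ← Matrix.one_sub_mobius_mul_conjTranspose hdx hdux hdss hdss' ht'b, ← hW,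
      replicateRow_mul_conjTranspose]
  have hwβ : 1 - rowMulStar w β = s * u * s := by
    rw [d_mul, d_mul] at hdw
    exact congrFun₂ hdw () ()
  have huU : IsUnit u := hxU.ringInverse
  refine ⟨fun i j => ?_, fun a i => ?_, ?_, ?_⟩
  · rw [replicateRow_conjTranspose_mul] at hWW
    have := congrFun₂ hWW i j
    rwa [Matrix.one_apply] at this
  · let D : Matrix (Fin n) (Fin n) B := Matrix.diagonal fun i => ((α i a : A) : B)
    have hcov_β (a : A) (i : Fin n) : (a : B) * β i = β i * ((α i a : A) : B) :=
      congrArg Subtype.val (hcov_b a i)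
    have cov_star {z : Fin n → B} (hz : ∀ (a : A) i, (a : B) * z i = z i * ((α i a : A) : B))
        (i : Fin n) : star (z i) * (a : B) = ((α i a : A) : B) * star (z i) := by
      have := congrArg star (hz (star a) i)
      simpa [map_star] using this
    have hab : d a * b' = b' * D := by
      ext _ j
      simp [d, D, b', Matrix.diagonal_mul, Matrix.mul_diagonal, hcov_β]
    have haV : d a * V = V * D := by
      ext _ j
      simp [d, D, V, Matrix.diagonal_mul, Matrix.mul_diagonal, hcov_v]
    have hba : b'.conjTranspose * d a = D * b'.conjTranspose := by
      ext j _
      simp [d, D, b', Matrix.diagonal_mul, Matrix.mul_diagonal, cov_star hcov_β]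
    have has : d s * d a = d a * d s := by
      apply Matrix.IsPositive.commute_of_mul_self hds_pos
      rw [hdss, Matrix.sub_mul, Matrix.mul_sub, Matrix.one_mul, Matrix.mul_one, Matrix.mul_assoc,
        hba, ← Matrix.mul_assoc, ← Matrix.mul_assoc, hab]
    have hDt : t * D = D * t := by
      apply Matrix.IsPositive.commute_of_mul_self ht_pos
      rw [htt, Matrix.sub_mul, Matrix.mul_sub, Matrix.one_mul, Matrix.mul_one, Matrix.mul_assoc,
        ← hab, ← Matrix.mul_assoc, ← Matrix.mul_assoc, hba]
    have hax : d x * d a = d a * d x := by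
      rw [hdx, Matrix.sub_mul, Matrix.mul_sub, Matrix.one_mul, Matrix.mul_one, Matrix.mul_assoc,
        hba, ← Matrix.mul_assoc, ← Matrix.mul_assoc, haV]
    have hau : d a * d u = d u * d a := by
      calc d a * d u = d u * (d x * d a) * d u := by
            rw [← Matrix.mul_assoc, hdux, Matrix.one_mul]
        _ = d u * d a := by
            rw [hax, Matrix.mul_assoc, Matrix.mul_assoc, hdxu, Matrix.mul_one]
    have hDt' : D * t' = t' * D := by
      calc D * t' = t' * (t * D) * t' := by
            rw [← Matrix.mul_assoc, ht't, Matrix.one_mul]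
        _ = t' * D := by
            rw [hDt, Matrix.mul_assoc, Matrix.mul_assoc, htt', Matrix.mul_one]
    have haW : d a * Matrix.replicateRow Unit w = Matrix.replicateRow Unit w * D := by
      calc d a * Matrix.replicateRow Unit w = d a * d s * d u * (b' - V) * t' := by
            rw [hW]; simp only [Matrix.mul_assoc]
        _ = d s * (d a * d u) * (b' - V) * t' := by rw [← has]; simp only [Matrix.mul_assoc]
        _ = d s * d u * (d a * (b' - V)) * t' := by rw [hau]; simp only [Matrix.mul_assoc]
        _ = d s * d u * (b' - V) * (D * t') := by
            rw [Matrix.mul_sub, hab, haV, ← Matrix.sub_mul]; simp only [Matrix.mul_assoc]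
        _ = Matrix.replicateRow Unit w * D := by
            rw [hDt', hW]; simp only [Matrix.mul_assoc]
    have := congrFun₂ haW () i
    simpa [d, D, Matrix.diagonal_mul, Matrix.mul_diagonal] using this
  · rw [hwβ]
    exact (hsu.mul huU).mul hsu
  · have hinv : Ring.inverse (1 - rowMulStar w β) = s' * x * s' := by
      rw [hwβ, Ring.inverse_mul (.inr hsu), Ring.inverse_mul (.inl hsu), Ring.inverse_inverse hxU,
        mul_assoc]
    have h := replicateRow_mobius s t β w
    rw [hinv] at h
    have h' : Matrix.replicateRow Unit (mobius s t β w) = V := by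
      rw [h, hW]
      have e := Matrix.mobius_mobius hdx hdxu htt htt' hdss' hds's hs'b
      rwa [d_mul s' x, d_mul _ s'] at e
    exact Matrix.replicateRow_injective h'
end
end
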